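/- Let ν > 0, L > 0, δ > 0, and let μ_δ be the triangular peridynamic kernel. Define u(x,t) = 2x/L + e^{-ν·t}·cos(2π·x/L) and f(x,t) = ν·{(6L²/(δ⁴·π²))·(cos(2π·δ/L) - 1) + 12/δ² - 1}·e^{-ν·t}·cos(2π·x/L). Then u solves the peridynamic diffusion equation: for all x ∈ ℝ and all t ∈ ℝ, ∂u/∂t (x,t) = ν·∫_{-δ}^{δ} μ_δ(ξ)·(u(x+ξ,t) - u(x,t)) dξ + f(x,t), where ∂u/∂t (x,t) denotes the derivative of the map t ↦ u(x,t). -/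

import Mathlib

open MeasureTheory intervalIntegral

/-- The triangular peridynamic kernel with horizon `δ`:
`μ_δ(ξ) = (12/δ³)·(1 - |ξ|/δ)` for `|ξ| ≤ δ` and `0` otherwise. -/
noncomputable def triKernel (δ : ℝ) (ξ : ℝ) : ℝ :=
  if |ξ| ≤ δ then (12 / δ ^ 3) * (1 - |ξ| / δ) else 0

/-- On the symmetric interval `[-δ, δ]` a continuous function has the integral of its
even part doubled, taken over `[0, δ]`. -/
theorem integral_symm_eq_integral_add_comp_neg {g : ℝ → ℝ} (hg : Continuous g) (δ : ℝ) :
    ∫ ξ in (-δ)..δ, g ξ = ∫ ξ in (0 : ℝ)..δ, (g ξ + g (-ξ)) := by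
  have hneg : Continuous fun ξ => g (-ξ) := hg.comp continuous_neg
  rw [intervalIntegral.integral_add (hg.intervalIntegrable _ _) (hneg.intervalIntegrable _ _),
    intervalIntegral.integral_comp_neg, neg_zero, add_comm,
    intervalIntegral.integral_add_adjacent_intervals (hg.intervalIntegrable _ _)
      (hg.intervalIntegrable _ _)]

theorem integral_one_sub_div_mul_cos_sub_one {k δ : ℝ} (hk : k ≠ 0) (hδ : δ ≠ 0) :
    ∫ ξ in (0 : ℝ)..δ, (1 - ξ / δ) * (Real.cos (k * ξ) - 1)
      = (1 - Real.cos (k * δ)) / (δ * k ^ 2) - δ / 2 := by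
  have hderiv : ∀ ξ ∈ Set.uIcc 0 δ, HasDerivAt
      (fun ξ => (1 - ξ / δ) * (Real.sin (k * ξ) / k) - Real.cos (k * ξ) / (δ * k ^ 2)
        - ξ + ξ ^ 2 / (2 * δ))
      ((1 - ξ / δ) * (Real.cos (k * ξ) - 1)) ξ := by
    intro ξ _
    have hlin : HasDerivAt (fun ξ => k * ξ) k ξ := by
      simpa using (hasDerivAt_id ξ).const_mul k
    have hsub : HasDerivAt (fun ξ => 1 - ξ / δ) (-(1 / δ)) ξ :=
      ((hasDerivAt_id ξ).div_const δ).const_sub 1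
    have h := (((hsub.mul (hlin.sin.div_const k)).sub
      (hlin.cos.div_const (δ * k ^ 2))).sub (hasDerivAt_id ξ)).add
      (((hasDerivAt_id ξ).pow 2).div_const (2 * δ))
    refine h.congr_deriv ?_
    simp only [id]
    field_simp
    ring
  rw [intervalIntegral.integral_eq_sub_of_hasDerivAt hderiv
    (Continuous.intervalIntegrable (by fun_prop) _ _)]
  simp only [mul_zero, Real.sin_zero, Real.cos_zero]
  field_simp
  ring

/-- The peridynamic Laplacian with the triangular kernel of an affine function plus a
cosine wave. -/
theorem integral_triKernel_mul_linear_add_cos {k δ : ℝ} (hk : k ≠ 0) (hδ : 0 < δ)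
    (a b x : ℝ) :
    ∫ ξ in (-δ)..δ, triKernel δ ξ *
        ((a * (x + ξ) + b * Real.cos (k * (x + ξ))) - (a * x + b * Real.cos (k * x)))
      = (24 / (δ ^ 4 * k ^ 2) * (1 - Real.cos (k * δ)) - 12 / δ ^ 2)
        * (b * Real.cos (k * x)) := by
  have hcongr : ∫ ξ in (-δ)..δ, triKernel δ ξ *
        ((a * (x + ξ) + b * Real.cos (k * (x + ξ))) - (a * x + b * Real.cos (k * x)))
      = ∫ ξ in (-δ)..δ, (12 / δ ^ 3) * (1 - |ξ| / δ) *
        ((a * (x + ξ) + b * Real.cos (k * (x + ξ))) - (a * x + b * Real.cos (k * x))) := by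
    refine intervalIntegral.integral_congr fun ξ hξ => ?_
    rw [Set.uIcc_of_le (by linarith)] at hξ
    simp only [triKernel, if_pos (abs_le.mpr hξ)]
  have hfold : ∀ ξ ∈ Set.uIcc 0 δ,
      (12 / δ ^ 3) * (1 - |ξ| / δ) *
        ((a * (x + ξ) + b * Real.cos (k * (x + ξ))) - (a * x + b * Real.cos (k * x)))
      + (12 / δ ^ 3) * (1 - |-ξ| / δ) *
        ((a * (x + -ξ) + b * Real.cos (k * (x + -ξ))) - (a * x + b * Real.cos (k * x)))
      = (24 / δ ^ 3 * (b * Real.cos (k * x))) * ((1 - ξ / δ) * (Real.cos (k * ξ) - 1)) := by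
    intro ξ hξ
    rw [Set.uIcc_of_le hδ.le] at hξ
    rw [abs_neg, abs_of_nonneg hξ.1, mul_add k x ξ, mul_add k x (-ξ), mul_neg,
      Real.cos_add, Real.cos_add, Real.cos_neg, Real.sin_neg]
    ring
  rw [hcongr, integral_symm_eq_integral_add_comp_neg (by fun_prop),
    intervalIntegral.integral_congr hfold, intervalIntegral.integral_const_mul,
    integral_one_sub_div_mul_cos_sub_one hk hδ.ne']
  field_simp
  ring

/-- `u(x,t) = 2x/L + e^{-νt} cos(2πx/L)` solves the peridynamic diffusion
equation `∂u/∂t = ν·L_δ u + f` with the manufactured source term `f`. -/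
theorem manufactured_solution_neumann
    (ν L δ : ℝ) (hν : 0 < ν) (hL : 0 < L) (hδ : 0 < δ)
    (u f : ℝ → ℝ → ℝ)
    (hu : ∀ x t : ℝ, u x t = 2 * x / L + Real.exp (-ν * t) * Real.cos (2 * Real.pi * x / L))
    (hf : ∀ x t : ℝ, f x t =
      ν * ((6 * L ^ 2 / (δ ^ 4 * Real.pi ^ 2)) * (Real.cos (2 * Real.pi * δ / L) - 1)
            + 12 / δ ^ 2 - 1) * Real.exp (-ν * t) * Real.cos (2 * Real.pi * x / L))
    (x t : ℝ) :
    HasDerivAt (fun s => u x s)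
      (ν * (∫ ξ in (-δ)..δ, triKernel δ ξ * (u (x + ξ) t - u x t)) + f x t) t := by
  have hk : 2 * Real.pi / L ≠ 0 := by positivity
  have hu' : ∀ y s : ℝ, u y s
      = 2 / L * y + Real.exp (-ν * s) * Real.cos (2 * Real.pi / L * y) := by
    intro y s
    rw [hu, mul_div_right_comm 2 y L, mul_div_right_comm (2 * Real.pi) y L]
  have hexp : HasDerivAt (fun s => Real.exp (-ν * s)) (Real.exp (-ν * t) * -ν) t := by
    simpa using ((hasDerivAt_id t).const_mul (-ν)).exp
  simp only [hu', hf]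
  rw [integral_triKernel_mul_linear_add_cos hk hδ, mul_div_right_comm (2 * Real.pi) x L,
    mul_div_right_comm (2 * Real.pi) δ L]
  refine ((hexp.mul_const _).const_add _).congr_deriv ?_
  field_simp
  ring
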